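/- Let L_0+λL_1 be an m×n complex matrix pencil. For k≥1 let T̃_k∈ℂ^{mk×n(k+1)} be the block bidiagonal Toeplitz matrix whose (i,j) block (1≤i≤k, 1≤j≤k+1, blocks of size m×n) equals L_0 if i=j, L_1 if j=i+1, and 0 otherwise, and let ν_k = mk − rank(T̃_k) be its left nullity; set ν_0=ν_{−1}=0. Then for every integer j≥0, the number of left minimal indices of the pencil L_0+λL_1 equal to j is ν_{j−1}−2ν_j+ν_{j+1}. -/

import Mathlib

open Polynomial Matrix

noncomputable section

/-- The matrix pencil `L₀ + λ L₁` viewed as a polynomial matrix. -/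
def pencilMat {ι κ : Type*} (L0 L1 : Matrix ι κ ℂ) : Matrix ι κ (Polynomial ℂ) :=
  Matrix.of fun i j => Polynomial.C (L0 i j) + Polynomial.X * Polynomial.C (L1 i j)

/-- Entrywise evaluation of a polynomial matrix at a point. -/
def evalMat {ι κ : Type*} (P : Matrix ι κ (Polynomial ℂ)) (μ : ℂ) : Matrix ι κ ℂ :=
  P.map fun p => p.eval μ

/-- A polynomial matrix viewed over the field ℂ(λ) of rational functions. -/
def toRat {ι κ : Type*} (P : Matrix ι κ (Polynomial ℂ)) : Matrix ι κ (RatFunc ℂ) :=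
  P.map (algebraMap (Polynomial ℂ) (RatFunc ℂ))

/-- The normal rank of a polynomial matrix: its rank over ℂ(λ). -/
def normalRank {ι κ : Type*} [Fintype κ] (P : Matrix ι κ (Polynomial ℂ)) : ℕ :=
  (toRat P).rank

/-- The right nullspace of a polynomial matrix, as a ℂ(λ)-subspace of ℂ(λ)^κ. -/
def rightNullspace {ι κ : Type*} [Fintype κ] (P : Matrix ι κ (Polynomial ℂ)) :
    Submodule (RatFunc ℂ) (κ → RatFunc ℂ) :=
  LinearMap.ker (toRat P).mulVecLin

/-- The degree of a polynomial (column) vector: maximum of the degrees of its entries. -/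
def colDegree {ι : Type*} [Fintype ι] (v : ι → Polynomial ℂ) : ℕ :=
  Finset.univ.sup fun i => (v i).natDegree

/-- The columns of the polynomial matrix `N` form a minimal polynomial basis of the right
nullspace of `P`: they are a ℂ(λ)-basis of `rightNullspace P` and the sum of the column
degrees is minimal among all polynomial bases. -/
def IsMinimalBasis {ι κ : Type*} [Fintype ι] [Fintype κ] (P : Matrix ι κ (Polynomial ℂ))
    {p : ℕ} (N : Matrix κ (Fin p) (Polynomial ℂ)) : Prop :=
  LinearIndependent (RatFunc ℂ) (fun j : Fin p => fun i : κ => toRat N i j) ∧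
  Submodule.span (RatFunc ℂ) (Set.range fun j : Fin p => fun i : κ => toRat N i j)
    = rightNullspace P ∧
  ∀ M : Matrix κ (Fin p) (Polynomial ℂ),
    LinearIndependent (RatFunc ℂ) (fun j : Fin p => fun i : κ => toRat M i j) →
    Submodule.span (RatFunc ℂ) (Set.range fun j : Fin p => fun i : κ => toRat M i j)
      = rightNullspace P →
    (∑ j, colDegree fun i => N i j) ≤ ∑ j, colDegree fun i => M i j

/-- `x(λ)` is a right zero direction of order `k ≥ 1` for `P` at `λ₀`:
`x(λ₀) ≠ 0` and `P(λ)x(λ) = (λ-λ₀)^k v(λ)` with `v` defined and nonzero at `λ₀`. -/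
def IsZeroDirection {ι κ : Type*} [Fintype κ] (P : Matrix ι κ (Polynomial ℂ)) (lam0 : ℂ)
    (k : ℕ) (x : κ → Polynomial ℂ) : Prop :=
  0 < k ∧ (fun i => (x i).eval lam0) ≠ 0 ∧
  (∀ i, (Polynomial.X - Polynomial.C lam0) ^ k ∣ P.mulVec x i) ∧
  ¬ ∀ i, (Polynomial.X - Polynomial.C lam0) ^ (k + 1) ∣ P.mulVec x i

/-- `x(λ)` is a root polynomial of order (exactly) `k` at `λ₀` for `P`: it is a zero direction
of order `k` and, for every right minimal basis `N` of `P`, `[N(λ₀) x(λ₀)]` has full column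
rank. -/
def IsRootPoly {ι κ : Type*} [Fintype ι] [Fintype κ] (P : Matrix ι κ (Polynomial ℂ)) (lam0 : ℂ)
    (k : ℕ) (x : κ → Polynomial ℂ) : Prop :=
  IsZeroDirection P lam0 k x ∧
  ∀ (p : ℕ) (N : Matrix κ (Fin p) (Polynomial ℂ)), IsMinimalBasis P N →
    (Matrix.of fun (i : κ) (j : Sum (Fin p) (Fin 1)) =>
      Sum.elim (fun a => (N i a).eval lam0) (fun _ => (x i).eval lam0) j).rank = p + 1

/-- `r 0, …, r (s-1)` is a `λ₀`-independent set of root polynomials of orders `k 0, …, k (s-1)`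
for `P`: each is a root polynomial and `[N(λ₀) r₁(λ₀) … r_s(λ₀)]` has full column rank for
every right minimal basis `N`. -/
def IsIndepFamily {ι κ : Type*} [Fintype ι] [Fintype κ] (P : Matrix ι κ (Polynomial ℂ))
    (lam0 : ℂ) {s : ℕ} (k : Fin s → ℕ) (r : Fin s → κ → Polynomial ℂ) : Prop :=
  (∀ i, IsRootPoly P lam0 (k i) (r i)) ∧
  ∀ (p : ℕ) (N : Matrix κ (Fin p) (Polynomial ℂ)), IsMinimalBasis P N →
    (Matrix.of fun (i : κ) (j : Sum (Fin p) (Fin s)) =>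
      Sum.elim (fun a => (N i a).eval lam0) (fun b => (r b i).eval lam0) j).rank = p + s

/-- A complete set of root polynomials: a `λ₀`-independent set such that no `λ₀`-independent
set with more elements exists. -/
def IsCompleteFamily {ι κ : Type*} [Fintype ι] [Fintype κ] (P : Matrix ι κ (Polynomial ℂ))
    (lam0 : ℂ) {s : ℕ} (k : Fin s → ℕ) (r : Fin s → κ → Polynomial ℂ) : Prop :=
  IsIndepFamily P lam0 k r ∧
  ∀ (s' : ℕ) (k' : Fin s' → ℕ) (r' : Fin s' → κ → Polynomial ℂ),
    IsIndepFamily P lam0 k' r' → s' ≤ s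

/-- A maximal set of root polynomials at `λ₀`: complete, ordered (`k₁ ≥ … ≥ k_s > 0`), and for
every `j` there is no root polynomial of order `> k j` that stays `λ₀`-independent together
with `r₁, …, r_{j-1}`. -/
def IsMaximalFamily {ι κ : Type*} [Fintype ι] [Fintype κ] (P : Matrix ι κ (Polynomial ℂ))
    (lam0 : ℂ) {s : ℕ} (k : Fin s → ℕ) (r : Fin s → κ → Polynomial ℂ) : Prop :=
  IsCompleteFamily P lam0 k r ∧ Antitone k ∧ (∀ i, 0 < k i) ∧
  ∀ (j : Fin s) (k' : ℕ), k j < k' → ∀ x : κ → Polynomial ℂ, IsRootPoly P lam0 k' x →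
    ¬ ∀ (p : ℕ) (N : Matrix κ (Fin p) (Polynomial ℂ)), IsMinimalBasis P N →
      (Matrix.of fun (i : κ) (c : Sum (Fin p) (Fin ((j : ℕ) + 1))) =>
        Sum.elim (fun a => (N i a).eval lam0)
          (fun b => if h : (b : ℕ) < (j : ℕ) then (r ⟨(b : ℕ), h.trans j.isLt⟩ i).eval lam0
                    else (x i).eval lam0) c).rank = p + (j : ℕ) + 1

/-- `σ 0 ≤ … ≤ σ (r-1)` are the partial multiplicities of `P` at `λ₀`: there is a local Smith
form `M(λ) P(λ) N(λ) = diag((λ-λ₀)^{σ i}) ⊕ 0` (up to positioning of the diagonal) with `M`,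
`N` polynomial and invertible at `λ₀`. -/
def HasPartialMultiplicities {ι κ : Type*} [Fintype ι] [Fintype κ] [DecidableEq ι]
    [DecidableEq κ] (P : Matrix ι κ (Polynomial ℂ)) (lam0 : ℂ) {r : ℕ} (σ : Fin r → ℕ) : Prop :=
  Monotone σ ∧
  ∃ (M : Matrix ι ι (Polynomial ℂ)) (N : Matrix κ κ (Polynomial ℂ))
    (fR : Fin r → ι) (fC : Fin r → κ),
    Function.Injective fR ∧ Function.Injective fC ∧
    (evalMat M lam0).det ≠ 0 ∧ (evalMat N lam0).det ≠ 0 ∧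
    M * P * N = Matrix.of fun i j =>
      ∑ a : Fin r, if i = fR a ∧ j = fC a then (Polynomial.X - Polynomial.C lam0) ^ σ a else 0

/-- The conjugate transpose of a polynomial matrix (conjugation applied coefficientwise), so
that `y(λ)^* P(λ) = 0` (identically in `λ`) iff `polyConjTranspose P *ᵥ y = 0`; the left
nullspace of `P` is the right nullspace of `polyConjTranspose P` and the left minimal indices
of `P` are the minimal indices of that subspace. -/
def polyConjTranspose {ι κ : Type*} (P : Matrix ι κ (Polynomial ℂ)) :
    Matrix κ ι (Polynomial ℂ) :=
  Matrix.of fun j i => (P i j).map (starRingEnd ℂ)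

/-- A polynomial vector lies in the right nullspace of `P` over `ℂ(λ)` iff `P z = 0` over
`ℂ[λ]`. -/
theorem algebraMap_comp_mem_rightNullspace_iff {ι κ : Type*} [Fintype κ]
    {P : Matrix ι κ ℂ[X]} {z : κ → ℂ[X]} :
    algebraMap ℂ[X] (RatFunc ℂ) ∘ z ∈ rightNullspace P ↔ P *ᵥ z = 0 := by
  have h : toRat P *ᵥ (algebraMap ℂ[X] (RatFunc ℂ) ∘ z)
      = algebraMap ℂ[X] (RatFunc ℂ) ∘ (P *ᵥ z) := by
    ext i
    simp [toRat, RingHom.map_mulVec]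
  rw [rightNullspace, LinearMap.mem_ker, mulVecLin_apply, h]
  simp [funext_iff]

/-- Polynomial vectors with linearly independent leading coefficient vectors are linearly
independent over the polynomial ring. -/
theorem linearIndependent_of_coeff {ι κ : Type*} (v : ι → κ → ℂ[X]) (d : ι → ℕ)
    (hd : ∀ c i, (v c i).natDegree ≤ d c)
    (hv : LinearIndependent ℂ fun c i => (v c i).coeff (d c)) :
    LinearIndependent ℂ[X] v := by
  rw [linearIndependent_iff'] at hv ⊢
  intro s g hg
  by_contra! hne
  obtain ⟨c₁, hc₁, hgc₁⟩ := hne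
  obtain ⟨c₀, hc₀, hmax⟩ := (s.filter fun c => g c ≠ 0).exists_max_image
    (fun c => (g c).natDegree + d c) ⟨c₁, by simp [hc₁, hgc₁]⟩
  rw [Finset.mem_filter] at hc₀
  set M := (g c₀).natDegree + d c₀ with hM
  have key := hv s (fun c => (g c).coeff (M - d c)) ?_ c₀ hc₀.1
  · rw [hM, Nat.add_sub_cancel, coeff_natDegree, leadingCoeff_eq_zero] at key
    exact hc₀.2 key
  · ext i
    have hi := congrArg (fun p => coeff p M) (congrFun hg i)
    simp only [Finset.sum_apply, Pi.smul_apply, smul_eq_mul, Pi.zero_apply, finsetSum_coeff,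
      coeff_zero] at hi ⊢
    rw [← hi]
    refine Finset.sum_congr rfl fun c hc => ?_
    by_cases h0 : g c = 0
    · simp [h0]
    · have hle : (g c).natDegree + d c ≤ M := hmax c (by simp [hc, h0])
      conv_rhs => rw [← Nat.sub_add_cancel (show d c ≤ M by omega)]
      exact (coeff_mul_add_eq_of_natDegree_le (by omega) (hd c i)).symm

theorem natDegree_le_colDegree {κ : Type*} [Fintype κ] (z : κ → ℂ[X]) (i : κ) :
    (z i).natDegree ≤ colDegree z :=
  Finset.le_sup (f := fun i => (z i).natDegree) (Finset.mem_univ i)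

theorem colDegree_lt_of_coeff_eq_zero {κ : Type*} [Fintype κ] {z : κ → ℂ[X]} (hz : z ≠ 0) {D : ℕ}
    (hd : ∀ i, (z i).natDegree ≤ D) (hc : ∀ i, (z i).coeff D = 0) : colDegree z < D := by
  have hlt : ∀ i, z i ≠ 0 → (z i).natDegree < D := fun i hi =>
    lt_of_le_of_ne (hd i) fun h => hi (leadingCoeff_eq_zero.1 (by rw [leadingCoeff, h, hc]))
  obtain ⟨i, hi⟩ := Function.ne_iff.1 hz
  have hD : 0 < D := (Nat.zero_le _).trans_lt (hlt i hi)
  refine (Finset.sup_lt_iff hD).2 fun i _ => ?_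
  by_cases h : z i = 0
  · simpa [h] using hD
  · exact hlt i h

namespace IsMinimalBasis

variable {ι κ : Type*} [Fintype ι] [Fintype κ] {P : Matrix ι κ ℂ[X]} {p : ℕ}
  {N : Matrix κ (Fin p) ℂ[X]}

theorem mulVec_col_eq_zero (hN : IsMinimalBasis P N) (c : Fin p) :
    P *ᵥ (fun i => N i c) = 0 :=
  algebraMap_comp_mem_rightNullspace_iff.1
    (hN.2.1 ▸ Submodule.subset_span (Set.mem_range_self c))

theorem linearIndependent_col (hN : IsMinimalBasis P N) :
    LinearIndependent ℂ[X] fun c i => N i c :=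
  linearIndependent_algebraMap_comp_iff.1 hN.1

theorem mulVec_sum_eq_zero (hN : IsMinimalBasis P N) (s : Finset (Fin p)) (q : Fin p → ℂ[X]) :
    P *ᵥ (∑ c ∈ s, q c • fun i => N i c) = 0 := by
  rw [mulVec_sum]
  exact Finset.sum_eq_zero fun c _ => by rw [mulVec_smul, hN.mulVec_col_eq_zero, smul_zero]

/-- Exchange property: a column of a minimal basis which contributes to a polynomial vector has
degree at most the degree of that vector. -/
theorem colDegree_le_of_coeff_ne_zero (hN : IsMinimalBasis P N) {z : κ → ℂ[X]}
    (l : Fin p → RatFunc ℂ)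
    (hl : algebraMap ℂ[X] (RatFunc ℂ) ∘ z = ∑ c, l c • fun i => toRat N i c)
    {c₀ : Fin p} (hc₀ : l c₀ ≠ 0) : colDegree (fun i => N i c₀) ≤ colDegree z := by
  obtain ⟨hli, hspan, hmin⟩ := hN
  set M : Matrix κ (Fin p) ℂ[X] :=
    of fun i c => Function.update (fun c i => N i c) c₀ z c i with hM
  have hMrat : (fun c i => toRat M i c)
      = Function.update (fun c i => toRat N i c) c₀ (algebraMap ℂ[X] (RatFunc ℂ) ∘ z) := by
    ext c i
    by_cases h : c = c₀
    · subst h; simp [hM, toRat]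
    · simp [hM, toRat, h]
  have hMli : LinearIndependent (RatFunc ℂ) (fun c i => toRat M i c) := by
    rw [hMrat]
    refine hli.update c₀ _ ⟨1, one_mem _, Finsupp.equivFunOnFinite.symm l, ?_, ?_⟩
    · simpa using hc₀
    · rw [one_smul, hl, Finsupp.linearCombination_apply, Finsupp.sum_fintype _ _ (by simp)]
      rfl
  have hMspan : Submodule.span (RatFunc ℂ) (Set.range fun c i => toRat M i c)
      = rightNullspace P := by
    refine Submodule.eq_of_le_of_finrank_eq ?_ ?_
    · rw [← hspan, Submodule.span_le, hMrat]
      rintro _ ⟨c, rfl⟩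
      by_cases h : c = c₀
      · subst h
        simp only [Function.update_self, hl]
        exact Submodule.sum_mem _ fun c _ =>
          Submodule.smul_mem _ _ (Submodule.subset_span ⟨c, rfl⟩)
      · simp only [Function.update_of_ne h]
        exact Submodule.subset_span ⟨c, rfl⟩
    · rw [← hspan, finrank_span_eq_card hMli, finrank_span_eq_card hli]
  have hle := hmin M hMli hMspan
  rw [← Finset.add_sum_erase _ _ (Finset.mem_univ c₀),
    ← Finset.add_sum_erase (a := c₀) _ (fun c => colDegree fun i => M i c) (Finset.mem_univ c₀)]
    at hle
  have hrest : ∑ c ∈ Finset.univ.erase c₀, colDegree (fun i => M i c)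
      = ∑ c ∈ Finset.univ.erase c₀, colDegree (fun i => N i c) :=
    Finset.sum_congr rfl fun c hc => by simp [hM, Finset.ne_of_mem_erase hc]
  have hself : (fun i => M i c₀) = z := by ext1 i; simp [hM]
  rw [hrest, hself] at hle
  exact Nat.le_of_add_le_add_right hle

/-- The leading coefficient vectors of a minimal basis are linearly independent. -/
theorem linearIndependent_leadingCoeff (hN : IsMinimalBasis P N) :
    LinearIndependent ℂ fun (c : Fin p) (i : κ) =>
      (N i c).coeff (colDegree fun i => N i c) := by
  rw [Fintype.linearIndependent_iff]
  intro a ha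
  by_contra! hne
  obtain ⟨c₁, hc₁⟩ := hne
  obtain ⟨c₀, hc₀, hmax⟩ := (Finset.univ.filter fun c => a c ≠ 0).exists_max_image
    (fun c => colDegree fun i => N i c) ⟨c₁, by simp [hc₁]⟩
  simp only [Finset.mem_filter, Finset.mem_univ, true_and] at hc₀ hmax
  set d : Fin p → ℕ := fun c => colDegree fun i => N i c with hd
  set q : Fin p → ℂ[X] := fun c => C (a c) * X ^ (d c₀ - d c) with hq
  set w : κ → ℂ[X] := ∑ c, q c • fun i => N i c with hw
  have hqne : q c₀ ≠ 0 := by simp [hq, hc₀]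
  have hwne : w ≠ 0 := fun h =>
    hqne (Fintype.linearIndependent_iff.1 hN.linearIndependent_col q h c₀)
  have hlow : d c₀ ≤ colDegree w := by
    refine hN.colDegree_le_of_coeff_ne_zero (fun c => algebraMap ℂ[X] (RatFunc ℂ) (q c)) ?_ ?_
    · ext i
      simp [hw, toRat, Algebra.smul_def]
    · simpa using hqne
  refine absurd hlow (not_le.2 (colDegree_lt_of_coeff_eq_zero hwne (fun i => ?_) fun i => ?_))
  · rw [hw, Finset.sum_apply]
    refine natDegree_sum_le_of_forall_le _ _ fun c _ => ?_
    by_cases h : a c = 0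
    · simp [hq, h]
    · have h1 := hmax c h
      have h2 : (N i c).natDegree ≤ d c := natDegree_le_colDegree (fun i => N i c) i
      have h3 : (C (a c) * X ^ (d c₀ - d c)).natDegree ≤ d c₀ - d c := natDegree_C_mul_X_pow_le _ _
      exact natDegree_mul_le.trans ((add_le_add h3 h2).trans (Nat.sub_add_cancel h1).le)
  · have hi := congrFun ha i
    simp only [Finset.sum_apply, Pi.smul_apply, smul_eq_mul, Pi.zero_apply] at hi
    simp only [hw, Finset.sum_apply, Pi.smul_apply, smul_eq_mul, finsetSum_coeff]
    rw [← hi]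
    refine Finset.sum_congr rfl fun c _ => ?_
    by_cases h : a c = 0
    · simp [hq, h]
    · have h1 := hmax c h
      rw [hq, mul_assoc, coeff_C_mul, coeff_X_pow_mul', if_pos (Nat.sub_le _ _),
        Nat.sub_sub_self h1]

/-- Polynomial vectors of degree less than `k` in the nullspace are spanned over `ℂ` by the
shifted columns of degree less than `k` of a minimal basis. -/
theorem mem_span_of_degree_lt (hN : IsMinimalBasis P N) (k : ℕ) (z : κ → ℂ[X])
    (hz : P *ᵥ z = 0) (hdeg : ∀ i, (z i).degree < k) :
    z ∈ Submodule.span ℂ (Set.range fun x : Σ c : Fin p, Fin (k - colDegree fun i => N i c) =>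
      (X : ℂ[X]) ^ (x.2 : ℕ) • fun i => N i x.1) := by
  induction k generalizing z with
  | zero =>
    have : z = 0 := by
      ext1 i
      simpa [Nat.WithBot.lt_zero_iff] using hdeg i
    exact this ▸ zero_mem _
  | succ k ih =>
    set d : Fin p → ℕ := fun c => colDegree fun i => N i c with hd
    have hdeg' : ∀ i, (z i).natDegree ≤ k := fun i =>
      natDegree_le_iff_coeff_eq_zero.2 ((degree_lt_iff_coeff_zero _ _).1 (hdeg i))
    obtain ⟨l, hl⟩ : ∃ l : Fin p → RatFunc ℂ,
        ∑ c, l c • (fun i => toRat N i c) = algebraMap ℂ[X] (RatFunc ℂ) ∘ z := by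
      rw [← Submodule.mem_span_range_iff_exists_fun, hN.2.1]
      exact algebraMap_comp_mem_rightNullspace_iff.2 hz
    have hlk : ∀ c, l c ≠ 0 → d c ≤ k := fun c hc =>
      (hN.colDegree_le_of_coeff_ne_zero l hl.symm hc).trans (Finset.sup_le fun i _ => hdeg' i)
    have hlead : (fun i => (z i).coeff k) ∈ Submodule.span ℂ
        (Set.range fun (c : {c // d c ≤ k}) (i : κ) => (N i c).coeff (d c)) := by
      by_contra hnot
      have hli := linearIndependent_of_coeff
        (fun o : Option {c // d c ≤ k} => o.elim z fun c i => N i c)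
        (fun o => o.elim k fun c => d c)
        (by rintro (_ | c) i
            · exact hdeg' i
            · exact natDegree_le_colDegree (fun i => N i c) i)
        (linearIndependent_option.2
          ⟨hN.linearIndependent_leadingCoeff.comp _ Subtype.val_injective, hnot⟩)
      refine (linearIndependent_option.1
        (linearIndependent_algebraMap_comp_iff (S := RatFunc ℂ).2 hli)).2 ?_
      change algebraMap ℂ[X] (RatFunc ℂ) ∘ z ∈ _
      rw [← hl]
      refine Submodule.sum_mem _ fun c _ => ?_
      by_cases hc : l c = 0
      · simp [hc]
      · exact Submodule.smul_mem _ _ (Submodule.subset_span ⟨⟨c, hlk c hc⟩, rfl⟩)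
    obtain ⟨a, ha⟩ := (Submodule.mem_span_range_iff_exists_fun ℂ).1 hlead
    set u : κ → ℂ[X] := ∑ c : {c // d c ≤ k}, a c • (X : ℂ[X]) ^ (k - d c) • fun i => N i c
      with hu
    have hu_null : P *ᵥ u = 0 := by
      rw [hu, mulVec_sum]
      refine Finset.sum_eq_zero fun c _ => ?_
      rw [mulVec_smul, mulVec_smul, hN.mulVec_col_eq_zero, smul_zero, smul_zero]
    have hu_span : u ∈ Submodule.span ℂ
        (Set.range fun x : Σ c : Fin p, Fin (k + 1 - d c) =>
          (X : ℂ[X]) ^ (x.2 : ℕ) • fun i => N i x.1) :=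
      Submodule.sum_mem _ fun c _ => Submodule.smul_mem _ _ (Submodule.subset_span
        ⟨⟨c, ⟨k - d c, by have := c.2; omega⟩⟩, rfl⟩)
    have hu_deg : ∀ i, (u i).natDegree ≤ k := fun i => by
      rw [hu, Finset.sum_apply]
      refine natDegree_sum_le_of_forall_le _ _ fun c _ => (natDegree_smul_le _ _).trans ?_
      have h : (N i c).natDegree ≤ d c := natDegree_le_colDegree (fun i => N i c) i
      exact natDegree_mul_le.trans
        ((add_le_add (natDegree_X_pow_le _) h).trans (Nat.sub_add_cancel c.2).le)
    have hu_coeff : ∀ i, (u i).coeff k = (z i).coeff k := fun i => by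
      rw [← congrFun ha i]
      simp only [hu, Finset.sum_apply, Pi.smul_apply, finsetSum_coeff, coeff_smul, smul_eq_mul]
      refine Finset.sum_congr rfl fun c _ => ?_
      rw [coeff_X_pow_mul', if_pos (Nat.sub_le _ _), Nat.sub_sub_self c.2]
    have hsub := ih (z - u) (by rw [mulVec_sub, hz, hu_null, sub_zero]) fun i => by
      rw [degree_lt_iff_coeff_zero]
      intro j hj
      rcases hj.eq_or_lt with rfl | hj
      · simp [hu_coeff]
      · simp [coeff_eq_zero_of_natDegree_lt ((hdeg' i).trans_lt hj),
          coeff_eq_zero_of_natDegree_lt ((hu_deg i).trans_lt hj)]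
    rw [← sub_add_cancel z u]
    refine add_mem (Submodule.span_mono ?_ hsub) hu_span
    rintro _ ⟨⟨c, i⟩, rfl⟩
    exact ⟨⟨c, ⟨i, i.2.trans_le (Nat.sub_le_sub_right k.le_succ _)⟩⟩, rfl⟩

theorem finrank_span_shifts (hN : IsMinimalBasis P N) (k : ℕ) :
    Module.finrank ℂ (Submodule.span ℂ
      (Set.range fun x : Σ c : Fin p, Fin (k - colDegree fun i => N i c) =>
        (X : ℂ[X]) ^ (x.2 : ℕ) • fun i => N i x.1))
      = ∑ c, (k - colDegree fun i => N i c) := by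
  have hX : LinearIndependent ℂ fun i : ℕ => (X : ℂ[X]) ^ i := by
    have := (basisMonomials ℂ).linearIndependent
    rw [coe_basisMonomials] at this
    simpa only [X_pow_eq_monomial] using this
  have hinj : Function.Injective
      fun x : Σ c : Fin p, Fin (k - colDegree fun i => N i c) => ((x.2 : ℕ), x.1) := by
    rintro ⟨c, i⟩ ⟨c', i'⟩ h
    obtain ⟨hi, hc⟩ := Prod.mk.inj h
    dsimp only at hi hc
    subst hc
    exact congrArg _ (Fin.ext hi)
  refine (finrank_span_eq_card
    ((linearIndependent_smul hX hN.linearIndependent_col).comp _ hinj)).trans ?_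
  simp

end IsMinimalBasis

/-- The polynomial vector of degree less than `k` with given coefficients. -/
def polyVecOfCoeffs (k : ℕ) (κ : Type*) : (Fin k × κ → ℂ) →ₗ[ℂ] κ → ℂ[X] where
  toFun y i := ∑ a : Fin k, monomial a (y (a, i))
  map_add' y z := by ext1 i; simp [Finset.sum_add_distrib]
  map_smul' r y := by ext1 i; simp [Finset.smul_sum, smul_monomial]

theorem polyVecOfCoeffs_apply {k : ℕ} {κ : Type*} (y : Fin k × κ → ℂ) (i : κ) :
    polyVecOfCoeffs k κ y i = ∑ a : Fin k, monomial a (y (a, i)) :=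
  rfl

theorem coeff_polyVecOfCoeffs {k : ℕ} {κ : Type*} (y : Fin k × κ → ℂ) (i : κ) (a : Fin k) :
    (polyVecOfCoeffs k κ y i).coeff a = y (a, i) := by
  simp [polyVecOfCoeffs_apply, coeff_monomial, Fin.val_inj]

theorem polyVecOfCoeffs_injective (k : ℕ) (κ : Type*) :
    Function.Injective (polyVecOfCoeffs k κ) := fun y z h => by
  ext ⟨a, i⟩
  rw [← coeff_polyVecOfCoeffs y, h, coeff_polyVecOfCoeffs]

theorem degree_polyVecOfCoeffs_lt {k : ℕ} {κ : Type*} (y : Fin k × κ → ℂ) (i : κ) :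
    (polyVecOfCoeffs k κ y i).degree < k := by
  rw [degree_lt_iff_coeff_zero]
  intro j hj
  rw [polyVecOfCoeffs_apply, finsetSum_coeff]
  exact Finset.sum_eq_zero fun a _ => coeff_monomial_of_ne _ (by omega)

theorem polyVecOfCoeffs_coeff {k : ℕ} {κ : Type*} (z : κ → ℂ[X]) (hz : ∀ i, (z i).degree < k) :
    polyVecOfCoeffs k κ (fun x => (z x.2).coeff x.1) = z := by
  ext i j
  by_cases hj : j < k
  · exact coeff_polyVecOfCoeffs (fun x : Fin k × κ => (z x.2).coeff x.1) i ⟨j, hj⟩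
  · rw [(degree_lt_iff_coeff_zero _ _).1 (hz i) j (not_lt.1 hj),
      (degree_lt_iff_coeff_zero _ _).1 (degree_polyVecOfCoeffs_lt _ i) j (not_lt.1 hj)]

/-- The block bidiagonal Toeplitz matrix with `L₀` on the block diagonal and `L₁` on the block
superdiagonal. -/
def toeplitzPencil {ι κ : Type*} (L0 L1 : Matrix ι κ ℂ) (k : ℕ) :
    Matrix (Fin k × ι) (Fin (k + 1) × κ) ℂ :=
  of fun p q =>
    if (p.1 : ℕ) = (q.1 : ℕ) then L0 p.2 q.2
    else if (q.1 : ℕ) = (p.1 : ℕ) + 1 then L1 p.2 q.2 else 0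

theorem coeff_linear_mul_monomial (α β t : ℂ) (a j : ℕ) :
    ((C α + X * C β) * monomial a t).coeff j
      = (if a = j then α else if j = a + 1 then β else 0) * t := by
  rw [add_mul, coeff_add, coeff_C_mul, mul_assoc]
  cases j with
  | zero => grind [coeff_monomial, mul_coeff_zero, coeff_X_zero]
  | succ j => rw [coeff_X_mul, coeff_C_mul]; grind [coeff_monomial]

section Toeplitz

variable {ι κ : Type*} [Fintype ι] (L0 L1 : Matrix ι κ ℂ) {k : ℕ}

theorem coeff_polyConjTranspose_pencilMat_mulVec (y : Fin k × ι → ℂ) (q : κ) (j : ℕ) :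
    ((polyConjTranspose (pencilMat L0 L1) *ᵥ polyVecOfCoeffs k ι y) q).coeff j
      = ∑ i, ∑ a : Fin k, (if (a : ℕ) = j then star (L0 i q)
          else if j = a + 1 then star (L1 i q) else 0) * y (a, i) := by
  simp only [mulVec, dotProduct, finsetSum_coeff, polyVecOfCoeffs_apply, Finset.mul_sum]
  refine Finset.sum_congr rfl fun i _ => Finset.sum_congr rfl fun a _ => ?_
  rw [← coeff_linear_mul_monomial]
  simp [polyConjTranspose, pencilMat]

theorem conjTranspose_toeplitzPencil_mulVec (y : Fin k × ι → ℂ) (q : Fin (k + 1) × κ) :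
    ((toeplitzPencil L0 L1 k)ᴴ *ᵥ y) q
      = ((polyConjTranspose (pencilMat L0 L1) *ᵥ polyVecOfCoeffs k ι y) q.2).coeff q.1 := by
  rw [coeff_polyConjTranspose_pencilMat_mulVec, mulVec, dotProduct, Fintype.sum_prod_type,
    Finset.sum_comm]
  refine Finset.sum_congr rfl fun i _ => Finset.sum_congr rfl fun a _ => ?_
  congr 1
  simp only [toeplitzPencil, conjTranspose_apply, of_apply]
  split_ifs <;> simp

theorem conjTranspose_toeplitzPencil_mulVec_eq_zero_iff (y : Fin k × ι → ℂ) :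
    (toeplitzPencil L0 L1 k)ᴴ *ᵥ y = 0
      ↔ polyConjTranspose (pencilMat L0 L1) *ᵥ polyVecOfCoeffs k ι y = 0 := by
  constructor
  · intro h
    ext q j
    by_cases hj : j < k + 1
    · exact (conjTranspose_toeplitzPencil_mulVec L0 L1 y (⟨j, hj⟩, q)).symm.trans (congrFun h _)
    · rw [coeff_polyConjTranspose_pencilMat_mulVec]
      refine Finset.sum_eq_zero fun i _ => Finset.sum_eq_zero fun a _ => ?_
      rw [if_neg (by omega), if_neg (by omega), zero_mul]
  · intro h
    ext q
    rw [conjTranspose_toeplitzPencil_mulVec, h]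
    simp

open scoped ComplexOrder in
/-- The left nullity of the Toeplitz matrix in terms of the left minimal indices. -/
theorem rank_toeplitzPencil_add_sum [Fintype κ] {p : ℕ} {N : Matrix ι (Fin p) ℂ[X]}
    (hN : IsMinimalBasis (polyConjTranspose (pencilMat L0 L1)) N) (k : ℕ) :
    (toeplitzPencil L0 L1 k).rank + ∑ c, (k - colDegree fun i => N i c)
      = Fintype.card ι * k := by
  have hmap : (LinearMap.ker (toeplitzPencil L0 L1 k)ᴴ.mulVecLin).map (polyVecOfCoeffs k ι)
      = Submodule.span ℂ
        (Set.range fun x : Σ c : Fin p, Fin (k - colDegree fun i => N i c) =>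
          (X : ℂ[X]) ^ (x.2 : ℕ) • fun i => N i x.1) := by
    apply le_antisymm
    · rintro _ ⟨y, hy, rfl⟩
      exact hN.mem_span_of_degree_lt k _
        ((conjTranspose_toeplitzPencil_mulVec_eq_zero_iff L0 L1 y).1 hy)
        (degree_polyVecOfCoeffs_lt y)
    · rw [Submodule.span_le]
      rintro _ ⟨⟨c, a⟩, rfl⟩
      have hdeg : ∀ i, (((X : ℂ[X]) ^ (a : ℕ) • fun i => N i c) i).degree < k := fun i => by
        have h1 : (N i c).natDegree ≤ colDegree fun i => N i c :=
          natDegree_le_colDegree (fun i => N i c) i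
        have h2 := a.2
        refine (degree_le_natDegree).trans_lt (Nat.cast_lt.2 ?_)
        exact natDegree_mul_le.trans_lt
          ((add_le_add (natDegree_X_pow_le _) h1).trans_lt (by omega))
      refine ⟨_, ?_, polyVecOfCoeffs_coeff _ hdeg⟩
      rw [SetLike.mem_coe, LinearMap.mem_ker, mulVecLin_apply,
        conjTranspose_toeplitzPencil_mulVec_eq_zero_iff, polyVecOfCoeffs_coeff _ hdeg,
        mulVec_smul, hN.mulVec_col_eq_zero, smul_zero]
  have hker := (Submodule.equivMapOfInjective _ (polyVecOfCoeffs_injective k ι)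
    (LinearMap.ker (toeplitzPencil L0 L1 k)ᴴ.mulVecLin)).finrank_eq
  rw [hmap, hN.finrank_span_shifts] at hker
  have hrn := LinearMap.finrank_range_add_finrank_ker (toeplitzPencil L0 L1 k)ᴴ.mulVecLin
  rw [hker, Module.finrank_fintype_fun_eq_card, Fintype.card_prod, Fintype.card_fin, mul_comm]
    at hrn
  rw [← rank_conjTranspose]
  exact hrn

end Toeplitz

/-- Karcanias–Kalogeropoulos. For `k ≥ 1` let `T̃_k` be the block bidiagonal
Toeplitz matrix with `L₀` on the block diagonal and `L₁` on the block superdiagonal, and let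
`ν_k = mk − rank T̃_k` be its left nullity (`ν₀ = ν₋₁ = 0`).  Then for every `j ≥ 0` the number
of left minimal indices of `L₀ + λL₁` equal to `j` is `ν_{j−1} − 2ν_j + ν_{j+1}`. -/
theorem count_left_minimal_indices_eq_toeplitz_nullities
    {m n : ℕ} (L0 L1 : Matrix (Fin m) (Fin n) ℂ) (ν : ℕ → ℤ) (hν0 : ν 0 = 0)
    (hν : ∀ k : ℕ, 1 ≤ k →
      ν k = (m * k : ℕ) -
        (Matrix.rank (Matrix.of fun (p : Fin k × Fin m) (q : Fin (k+1) × Fin n) =>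
          if (p.1 : ℕ) = (q.1 : ℕ) then L0 p.2 q.2
          else if (q.1 : ℕ) = (p.1 : ℕ) + 1 then L1 p.2 q.2 else 0) : ℕ)) :
    ∀ (j : ℕ) (p : ℕ) (N : Matrix (Fin m) (Fin p) (Polynomial ℂ)),
      IsMinimalBasis (polyConjTranspose (pencilMat L0 L1)) N →
      ((Finset.univ.filter fun c : Fin p => colDegree (fun i => N i c) = j).card : ℤ)
        = ν (j - 1) - 2 * ν j + ν (j + 1) := by
  intro j p N hN
  have hνsum : ∀ k, ν k = ∑ c, ((k - colDegree fun i => N i c : ℕ) : ℤ) := fun k => by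
    rcases Nat.eq_zero_or_pos k with rfl | hk
    · simp [hν0]
    · have h := rank_toeplitzPencil_add_sum L0 L1 hN k
      rw [Fintype.card_fin] at h
      rw [hν k hk, ← h]
      push_cast [toeplitzPencil]
      ring
  rw [hνsum, hνsum, hνsum, Finset.card_filter, Finset.mul_sum, ← Finset.sum_sub_distrib,
    ← Finset.sum_add_distrib]
  push_cast
  refine Finset.sum_congr rfl fun c _ => ?_
  split_ifs <;> omega

end
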